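/- arXiv:2303.02337 — 9 statements merged into one kernel-verified Lean document; each statement's English description precedes it below -/
import Mathlib

section
/- Let G be a finite connected vertex-coloured graph, let C be a consistent subset of G, let v ∉ C, and suppose u is the UNIQUE vertex of C with dist(v,u) = min_{w∈C} dist(v,w). Then col(u) = col(v), and every vertex lying on any shortest path from v to u has colour col(v). (Indeed, for every vertex u_i strictly between v and u on such a shortest path, u is again the unique nearest vertex of C to u_i.) -/
/-- `C` is a consistent subset of the vertex-coloured graph `(G, col)`:
for every vertex `v ∉ C` there is `u ∈ C` of the same colour whose hop-distance
to `v` is minimum among all vertices of `C`. -/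
def IsConsistent {V κ : Type*} (G : SimpleGraph V) (col : V → κ) (C : Set V) : Prop :=
  ∀ v ∉ C, ∃ u ∈ C, col u = col v ∧ ∀ w ∈ C, G.dist v u ≤ G.dist v w

namespace SimpleGraph

theorem Walk.dist_add_dist_eq_of_mem_support {V : Type*} {G : SimpleGraph V} {a b x : V}
    (p : G.Walk a b) (hp : p.length = G.dist a b) (hx : x ∈ p.support) :
    G.dist a x + G.dist x b = G.dist a b := by
  classical
  have hlen := congrArg Walk.length (p.take_spec hx)
  rw [Walk.length_append] at hlen
  have h₁ := dist_le (p.takeUntil x hx)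
  have h₂ := dist_le (p.dropUntil x hx)
  have h₃ := (p.takeUntil x hx).reachable.dist_triangle_left b
  omega

end SimpleGraph

theorem IsConsistent.color_eq_of_unique_nearest {V κ : Type*} {G : SimpleGraph V} {col : V → κ}
    {C : Set V} (hC : IsConsistent G col C) {x u : V} (hu : u ∈ C)
    (h : ∀ w ∈ C, G.dist x w ≤ G.dist x u → w = u) : col u = col x := by
  by_cases hx : x ∈ C
  · rw [h x hx (by simp)]
  · obtain ⟨w, hw, hcol, hle⟩ := hC x hx
    rwa [h w hw (hle u hu)] at hcol

/-- If `C` is a consistent subset, `v ∉ C`, and `u` is the unique vertex of `C` at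
minimum hop-distance from `v`, then `col u = col v`, every vertex on any shortest
path from `v` to `u` has colour `col v`, and moreover for every vertex strictly
between `v` and `u` on such a shortest path, `u` is again the unique nearest
vertex of `C`. -/
theorem unique_nearest_mono_shortest_path
    {V κ : Type*} [Fintype V] (G : SimpleGraph V) (hG : G.Connected)
    (col : V → κ) (C : Set V) (hC : IsConsistent G col C)
    (v : V) (hv : v ∉ C) (u : V) (hu : u ∈ C)
    (hmin : ∀ w ∈ C, G.dist v u ≤ G.dist v w)
    (huniq : ∀ w ∈ C, G.dist v w = G.dist v u → w = u) :
    col u = col v ∧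
      ∀ p : G.Walk v u, p.length = G.dist v u →
        (∀ x ∈ p.support, col x = col v) ∧
        ∀ x ∈ p.support, x ≠ v → x ≠ u →
          (∀ w ∈ C, G.dist x u ≤ G.dist x w) ∧
          (∀ w ∈ C, G.dist x w = G.dist x u → w = u) := by
  have nearest : ∀ x, G.dist v x + G.dist x u = G.dist v u →
      ∀ w ∈ C, G.dist x w ≤ G.dist x u → w = u := by
    intro x hx w hw hle
    have htri := hG.dist_triangle (u := v) (v := x) (w := w)
    have hvw := hmin w hw
    exact huniq w hw (by omega)
  have hcol : col u = col v := hC.color_eq_of_unique_nearest hu (nearest v (by simp))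
  refine ⟨hcol, fun p hp => ⟨fun x hx => ?_, fun x hx _ _ => ?_⟩⟩
  all_goals have hnear := nearest x (p.dist_add_dist_eq_of_mem_support hp hx)
  · rw [← hC.color_eq_of_unique_nearest hu hnear, hcol]
  · refine ⟨fun w hw => ?_, fun w hw h => hnear w hw h.le⟩
    rcases le_total (G.dist x u) (G.dist x w) with h | h
    · exact h
    · rw [hnear w hw h]
end

section
/- Let G be a spider with center v and let C be a consistent subset of G with v ∉ C. Then there exists a vertex u ∈ C with dist(v,u) = min_{w∈C} dist(v,w) and col(u) = col(v) such that every vertex on the unique path in G from v to u has colour col(v); equivalently, u belongs to the first run ρ_j of some leg V_j and col(ρ_j) = col(v). In particular, the vertex covering the center lies in the union of the center and the first runs. -/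
/-- `G` is a spider with center `v`: a tree in which every vertex other than the
center has degree at most `2`. -/
def IsSpider {V : Type*} [Fintype V] (G : SimpleGraph V) [DecidableRel G.Adj]
    (v : V) : Prop :=
  G.IsTree ∧ ∀ w : V, w ≠ v → G.degree w ≤ 2

/-- `u` belongs to the first run of its leg in the spider with center `v`:
`u ≠ v` and every vertex other than `v` on the (unique) path from `v` to `u`
has the same colour as `u`. -/
def InFirstRun {V κ : Type*} (G : SimpleGraph V) (col : V → κ) (v u : V) : Prop :=
  u ≠ v ∧ ∀ p : G.Walk v u, p.IsPath → ∀ x ∈ p.support, x ≠ v → col x = col u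

/-- The two halves of a walk at a vertex of its support bound the sum of the distances. -/
theorem SimpleGraph.Walk.dist_add_dist_le_length {V : Type*} {G : SimpleGraph V} {a b x : V}
    (p : G.Walk a b) (hx : x ∈ p.support) : G.dist a x + G.dist x b ≤ p.length := by
  classical
  have h := congrArg SimpleGraph.Walk.length (p.take_spec hx)
  rw [SimpleGraph.Walk.length_append] at h
  have h₁ := SimpleGraph.dist_le (p.takeUntil x hx)
  have h₂ := SimpleGraph.dist_le (p.dropUntil x hx)
  omega

/-- The neighbours of an inner vertex of degree at most `2` on a path lie on the path. -/
theorem SimpleGraph.Walk.IsPath.mem_support_of_adj_of_degree_le_two {V : Type*} [Fintype V]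
    {G : SimpleGraph V} [DecidableRel G.Adj] {a b x y : V} {p : G.Walk a b} (hp : p.IsPath)
    (hx : x ∈ p.support) (hxa : x ≠ a) (hxb : x ≠ b) (hdeg : G.degree x ≤ 2)
    (hxy : G.Adj x y) : y ∈ p.support := by
  classical
  obtain ⟨i, rfl, hi⟩ := SimpleGraph.Walk.mem_support_iff_exists_getVert.mp hx
  have hi₀ : i ≠ 0 := by
    rintro rfl
    exact hxa p.getVert_zero
  have hi₁ : i ≠ p.length := by
    rintro rfl
    exact hxb p.getVert_length
  obtain ⟨k, rfl⟩ := Nat.exists_eq_add_one_of_ne_zero hi₀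
  have hprev : G.Adj (p.getVert (k + 1)) (p.getVert k) :=
    (p.adj_getVert_succ (by omega)).symm
  have hnext : G.Adj (p.getVert (k + 1)) (p.getVert (k + 2)) :=
    p.adj_getVert_succ (by omega)
  have hne : p.getVert k ≠ p.getVert (k + 2) := by
    intro h
    have := hp.getVert_injOn (show k ≤ p.length by omega)
      (show k + 2 ≤ p.length by omega) h
    omega
  by_contra hy
  have hyk : ∀ j, p.getVert j ≠ y := fun j h => hy (h ▸ p.getVert_mem_support j)
  have hsub : ({p.getVert k, p.getVert (k + 2), y} : Finset V) ⊆
      G.neighborFinset (p.getVert (k + 1)) := by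
    intro z hz
    simp only [Finset.mem_insert, Finset.mem_singleton] at hz
    rw [SimpleGraph.mem_neighborFinset]
    rcases hz with rfl | rfl | rfl <;> assumption
  have hcard := Finset.card_le_card hsub
  rw [Finset.card_eq_three.mpr ⟨_, _, _, hne, hyk k, hyk (k + 2), rfl⟩,
    SimpleGraph.card_neighborFinset_eq_degree] at hcard
  omega

/-- A walk that starts on a path whose inner vertices have degree at most `2` either meets
an end of the path or never leaves it. -/
theorem SimpleGraph.Walk.IsPath.mem_support_or_mem_support_of_degree_le_two {V : Type*}
    [Fintype V] {G : SimpleGraph V} [DecidableRel G.Adj] {a b x w : V} {p : G.Walk a b}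
    (hp : p.IsPath) (hdeg : ∀ z, z ≠ a → G.degree z ≤ 2) (q : G.Walk x w)
    (hx : x ∈ p.support) : a ∈ q.support ∨ b ∈ q.support ∨ w ∈ p.support := by
  induction q with
  | nil => exact Or.inr (Or.inr hx)
  | @cons x y w hxy q ih =>
    simp only [SimpleGraph.Walk.support_cons, List.mem_cons]
    by_cases hxa : x = a
    · exact Or.inl (Or.inl hxa.symm)
    by_cases hxb : x = b
    · exact Or.inr (Or.inl (Or.inl hxb.symm))
    have := ih (hp.mem_support_of_adj_of_degree_le_two hx hxa hxb (hdeg x hxa) hxy)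
    tauto

/-- If `C` is a consistent subset of a spider `G` with center `v` and `v ∉ C`, then
some nearest vertex `u ∈ C` has `col u = col v` and every vertex on the unique
path from `v` to `u` has colour `col v`; i.e. `u` lies in the first run of its
leg and that first run has colour `col v`. -/
theorem center_covered_by_first_run
    {V κ : Type*} [Fintype V] (G : SimpleGraph V) [DecidableRel G.Adj]
    (col : V → κ) (v : V) (hsp : IsSpider G v)
    (C : Set V) (hC : IsConsistent G col C) (hv : v ∉ C) :
    ∃ u ∈ C, (∀ w ∈ C, G.dist v u ≤ G.dist v w) ∧ col u = col v ∧
      (∀ p : G.Walk v u, p.IsPath → ∀ x ∈ p.support, col x = col v) ∧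
      InFirstRun G col v u := by
  obtain ⟨u, huC, hcol, hmin⟩ := hC v hv
  have hconn : G.Connected := hsp.1.connected
  have hpath : ∀ p : G.Walk v u, p.IsPath → ∀ x ∈ p.support, col x = col v := by
    intro p hp x hx
    have hlen : p.length = G.dist v u := by
      obtain ⟨r, hr, hrlen⟩ := hconn.exists_path_of_dist v u
      rw [← hrlen, (hsp.1.existsUnique_path v u).unique hp hr]
    have hmem : ∀ w ∈ p.support, w ∈ C → w = u := by
      intro w hw hwC
      have h₁ := p.dist_add_dist_le_length hw
      have h₂ := hmin w hwC
      exact hconn.dist_eq_zero_iff.mp (by omega)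
    by_cases hxv : x = v
    · rw [hxv]
    by_cases hxC : x ∈ C
    · rw [hmem x hx hxC, hcol]
    obtain ⟨w, hwC, hwcol, hwmin⟩ := hC x hxC
    suffices w = u by rw [← hwcol, this, hcol]
    obtain ⟨q, hq⟩ := hconn.exists_walk_length_eq_dist x w
    have hwu := hwmin u huC
    rcases hp.mem_support_or_mem_support_of_degree_le_two hsp.2 q hx with h | h | h
    · have h₁ := q.dist_add_dist_le_length h
      have h₂ := p.dist_add_dist_le_length hx
      have h₃ := hmin w hwC
      have h₄ := hconn.pos_dist_of_ne hxv
      omega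
    · have h₁ := q.dist_add_dist_le_length h
      exact (hconn.dist_eq_zero_iff.mp (by omega)).symm
    · exact hmem w h hwC
  exact ⟨u, huC, hmin, hcol, hpath, fun h => hv (h ▸ huC),
    fun p hp x hx _ => (hpath p hp x hx).trans hcol.symm⟩
end

section
/- Let G be a spider with center v such that every neighbour of v has a colour different from col(v) (equivalently, col(ρ_i) ≠ col(v) for the first run ρ_i of every leg V_i). Then v belongs to every consistent subset of G. -/
/-- The last step of a geodesic: a vertex at distance `k + 1` from `a` has a neighbour at
distance `k` from `a`. -/
theorem SimpleGraph.Connected.exists_adj_dist_eq_of_dist_eq_succ {V : Type*}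
    {G : SimpleGraph V} (hG : G.Connected) {a b : V} {k : ℕ} (h : G.dist a b = k + 1) :
    ∃ c, G.Adj b c ∧ G.dist a c = k := by
  rw [SimpleGraph.dist_comm] at h
  obtain ⟨p, hp⟩ := hG.exists_walk_length_eq_dist b a
  rw [h] at hp
  cases p with
  | nil => simp at hp
  | @cons _ c _ hbc q =>
    refine ⟨c, hbc, ?_⟩
    have hq := SimpleGraph.dist_le q
    have htri := hG.dist_triangle (u := b) (v := c) (w := a)
    have hone := SimpleGraph.dist_eq_one_iff_adj.mpr hbc
    rw [SimpleGraph.Walk.length_cons] at hp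
    rw [SimpleGraph.dist_comm]
    omega

/-- In a connected graph in which every vertex other than `v` has degree at most `2`, a vertex
that `v` reaches by a geodesic through its neighbour `w` is determined by its distance to `v`. -/
theorem SimpleGraph.Connected.eq_of_dist_eq_of_adj_of_degree_le_two {V : Type*} [Fintype V]
    {G : SimpleGraph V} [DecidableRel G.Adj] (hG : G.Connected) {v w : V}
    (hdeg : ∀ x, x ≠ v → G.degree x ≤ 2) (hvw : G.Adj v w) {k : ℕ} {x y : V}
    (hwx : G.dist w x = k) (hwy : G.dist w y = k)
    (hvx : G.dist v x = k + 1) (hvy : G.dist v y = k + 1) : x = y := by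
  classical
  induction k generalizing x y with
  | zero => exact (hG.dist_eq_zero_iff.mp hwx).symm.trans (hG.dist_eq_zero_iff.mp hwy)
  | succ k ih =>
    have hone := SimpleGraph.dist_eq_one_iff_adj.mpr hvw
    have pred : ∀ z, G.dist w z = k + 1 → G.dist v z = k + 1 + 1 →
        ∃ c, G.Adj z c ∧ G.dist w c = k ∧ G.dist v c = k + 1 := by
      intro z hwz hvz
      obtain ⟨c, hzc, hwc⟩ := hG.exists_adj_dist_eq_of_dist_eq_succ hwz
      have h₁ := hG.dist_triangle (u := v) (v := w) (w := c)
      have h₂ := hG.dist_triangle (u := v) (v := c) (w := z)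
      have h₃ := SimpleGraph.dist_eq_one_iff_adj.mpr hzc.symm
      exact ⟨c, hzc, hwc, by omega⟩
    obtain ⟨p, hxp, hwp, hvp⟩ := pred x hwx hvx
    obtain ⟨p', hyp, hwp', hvp'⟩ := pred y hwy hvy
    obtain rfl := ih hwp hwp' hvp hvp'
    obtain ⟨q, hpq, hvq⟩ := hG.exists_adj_dist_eq_of_dist_eq_succ hvp
    have hpv : p ≠ v := by
      rintro rfl
      simp at hvp
    by_contra hxy
    have hqx : q ≠ x := by
      rintro rfl
      omega
    have hqy : q ≠ y := by
      rintro rfl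
      omega
    have hsub : ({q, x, y} : Finset V) ⊆ G.neighborFinset p := by
      intro z hz
      simp only [Finset.mem_insert, Finset.mem_singleton] at hz
      rw [SimpleGraph.mem_neighborFinset]
      rcases hz with rfl | rfl | rfl
      exacts [hpq, hxp.symm, hyp.symm]
    have hcard := Finset.card_le_card hsub
    rw [Finset.card_eq_three.mpr ⟨q, x, y, hqx, hqy, hxy, rfl⟩,
      SimpleGraph.card_neighborFinset_eq_degree] at hcard
    have := hdeg p hpv
    omega

/-- If every neighbour of the center `v` of a spider has a colour different from
`col v` (equivalently, no first run has colour `col v`), then `v` belongs to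
every consistent subset of the spider. -/
theorem center_mem_of_no_same_colour_neighbour
    {V κ : Type*} [Fintype V] (G : SimpleGraph V) [DecidableRel G.Adj]
    (col : V → κ) (v : V) (hsp : IsSpider G v)
    (hcol : ∀ w : V, G.Adj v w → col w ≠ col v)
    (C : Set V) (hC : IsConsistent G col C) :
    v ∈ C := by
  have hG := hsp.1.connected
  by_contra hv
  obtain ⟨u, huC, hu, hmin⟩ := hC v hv
  obtain ⟨d, hd⟩ : ∃ d, G.dist v u = d + 1 := by
    refine Nat.exists_eq_succ_of_ne_zero fun h => hv ?_
    rwa [hG.dist_eq_zero_iff.mp h]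
  rw [SimpleGraph.dist_comm] at hd
  obtain ⟨w, hvw, hwu⟩ := hG.exists_adj_dist_eq_of_dist_eq_succ hd
  rw [SimpleGraph.dist_comm] at hd hwu
  have hone := SimpleGraph.dist_eq_one_iff_adj.mpr hvw
  have hwC : w ∉ C := by
    intro hw
    have hle := hmin w hw
    have hzero : G.dist w u = 0 := by omega
    rw [hG.dist_eq_zero_iff] at hzero
    exact hcol w hvw (hzero ▸ hu)
  obtain ⟨x, hxC, hx, hxmin⟩ := hC w hwC
  have h₁ := hmin x hxC
  have h₂ := hxmin u huC
  have h₃ := hG.dist_triangle (u := v) (v := w) (w := x)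
  have hux : u = x := hG.eq_of_dist_eq_of_adj_of_degree_le_two hsp.2 hvw (k := d)
    hwu (by omega) hd (by omega)
  exact hcol w hvw (by rw [← hx, ← hux, hu])
end

section
/- Let G be a spider with center v and legs V_1,…,V_{k_1}, and let S be a set of vertices of G with v ∈ S. Then S is a consistent subset of G if and only if, for every i ∈ {1,…,k_1}, the set (S ∩ V_i) ∪ {v} is a consistent subset of the subgraph of G induced on V_i ∪ {v} (which is a path), with the induced colouring. -/
/-- `legs` enumerates the legs of the spider with center `v`: the connected
components of `G − v`. They are pairwise disjoint, cover all vertices other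
than `v`, each induces a connected subgraph, and there is no edge of `G`
between two different legs. -/
def AreLegs {V : Type*} (G : SimpleGraph V) (v : V) {k : ℕ}
    (legs : Fin k → Set V) : Prop :=
  (⋃ i, legs i) = {v}ᶜ ∧
  (∀ i j, i ≠ j → Disjoint (legs i) (legs j)) ∧
  (∀ i, (G.induce (legs i)).Connected) ∧
  (∀ i j, i ≠ j → ∀ a ∈ legs i, ∀ b ∈ legs j, ¬ G.Adj a b)

/-- A neighbour of a vertex of a leg lies in the same leg or is the center. -/
theorem AreLegs.mem_of_adj {V : Type*} {G : SimpleGraph V} {v : V} {k : ℕ}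
    {legs : Fin k → Set V} (h : AreLegs G v legs) {i : Fin k} {a b : V}
    (ha : a ∈ legs i) (hab : G.Adj a b) : b ∈ legs i ∪ {v} := by
  by_cases hb : b = v
  · exact Or.inr hb
  · have hmem : b ∈ ⋃ j, legs j := by rw [h.1]; exact hb
    obtain ⟨j, hj⟩ := Set.mem_iUnion.1 hmem
    by_cases hij : i = j
    · exact Or.inl (hij ▸ hj)
    · exact absurd hab (h.2.2.2 i j hij a ha b hj)

open Classical in
/-- The retraction of the vertex set onto a leg together with the center,
collapsing every other leg to the center. -/
noncomputable def legRetraction {V : Type*} (L : Set V) (v x : V) : ↥(L ∪ {v}) :=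
  if hx : x ∈ L then ⟨x, Or.inl hx⟩ else ⟨v, Or.inr rfl⟩

theorem legRetraction_coe {V : Type*} (L : Set V) (v : V) (x : ↥(L ∪ {v})) :
    legRetraction L v x = x := by
  obtain ⟨x, hx⟩ := x
  unfold legRetraction
  split_ifs with h
  · rfl
  · exact Subtype.ext (hx.resolve_left h).symm

/-- Collapsing the other legs does not lengthen walks. -/
theorem AreLegs.exists_retracted_walk {V : Type*} {G : SimpleGraph V} {v : V} {k : ℕ}
    {legs : Fin k → Set V} (h : AreLegs G v legs) (i : Fin k) {x y : V} (p : G.Walk x y) :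
    ∃ q : (G.induce (legs i ∪ {v})).Walk
      (legRetraction (legs i) v x) (legRetraction (legs i) v y), q.length ≤ p.length := by
  induction p with
  | nil => exact ⟨.nil, le_rfl⟩
  | @cons a b c hab p ih =>
    obtain ⟨q, hq⟩ := ih
    have key : legRetraction (legs i) v a = legRetraction (legs i) v b ∨
        (G.induce (legs i ∪ {v})).Adj
          (legRetraction (legs i) v a) (legRetraction (legs i) v b) := by
      unfold legRetraction
      split_ifs with ha hb hb
      · exact Or.inr hab
      · obtain rfl : b = v := (h.mem_of_adj ha hab).resolve_left hb
        exact Or.inr hab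
      · obtain rfl : a = v := (h.mem_of_adj hb hab.symm).resolve_left ha
        exact Or.inr hab
      · exact Or.inl rfl
    rcases key with heq | hadj
    · rw [heq]
      exact ⟨q, by rw [SimpleGraph.Walk.length_cons]; omega⟩
    · exact ⟨.cons hadj q, by simpa using hq⟩

/-- A leg together with the center is isometrically embedded. -/
theorem AreLegs.dist_induce {V : Type*} {G : SimpleGraph V} {v : V} {k : ℕ}
    {legs : Fin k → Set V} (h : AreLegs G v legs) (hG : G.Connected) (i : Fin k)
    (x y : ↥(legs i ∪ {v})) :
    (G.induce (legs i ∪ {v})).dist x y = G.dist x y := by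
  obtain ⟨p, hp⟩ := hG.exists_walk_length_eq_dist (x : V) y
  have hwalk := h.exists_retracted_walk i p
  rw [legRetraction_coe, legRetraction_coe] at hwalk
  obtain ⟨q, hq⟩ := hwalk
  apply le_antisymm
  · exact (SimpleGraph.dist_le q).trans (hq.trans hp.le)
  · obtain ⟨r, hr⟩ := q.reachable.exists_walk_length_eq_dist
    rw [← hr, ← r.length_map (SimpleGraph.Embedding.induce (legs i ∪ {v})).toHom]
    exact SimpleGraph.dist_le _

/-- A walk leaving a leg passes through the center. -/
theorem AreLegs.center_mem_support {V : Type*} {G : SimpleGraph V} {v : V} {k : ℕ}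
    {legs : Fin k → Set V} (h : AreLegs G v legs) {i : Fin k} {x y : V} (p : G.Walk x y)
    (hx : x ∈ legs i) (hy : y ∉ legs i) : v ∈ p.support := by
  induction p with
  | nil => exact absurd hx hy
  | cons hab p ih =>
    rw [SimpleGraph.Walk.support_cons]
    rcases h.mem_of_adj hx hab with hb | rfl
    · exact List.mem_cons_of_mem _ (ih hb hy)
    · exact List.mem_cons_of_mem _ p.start_mem_support

/-- From a vertex of a leg, the center is strictly closer than any vertex of another leg. -/
theorem AreLegs.dist_center_lt {V : Type*} {G : SimpleGraph V} {v : V} {k : ℕ}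
    {legs : Fin k → Set V} (h : AreLegs G v legs) (hG : G.Connected) {i : Fin k} {x y : V}
    (hx : x ∈ legs i) (hy : y ∉ legs i ∪ {v}) : G.dist x v < G.dist x y := by
  classical
  obtain ⟨p, hp⟩ := hG.exists_walk_length_eq_dist x y
  have hv := h.center_mem_support p hx fun hy' => hy (Or.inl hy')
  rw [← hp]
  exact (SimpleGraph.dist_le _).trans_lt
    (SimpleGraph.Walk.length_takeUntil_lt_length hv fun hvy => hy (Or.inr hvy.symm))

/-- Let `G` be a spider with center `v` and legs `legs`, and `S` a set of vertices
with `v ∈ S`. Then `S` is a consistent subset of `G` iff for every leg `V_i`,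
the set `(S ∩ V_i) ∪ {v}` is a consistent subset of the subgraph induced on
`V_i ∪ {v}` with the induced colouring. -/
theorem consistent_iff_consistent_on_each_leg
    {V κ : Type*} [Fintype V] (G : SimpleGraph V) [DecidableRel G.Adj]
    (col : V → κ) (v : V) (hsp : IsSpider G v)
    {k : ℕ} (legs : Fin k → Set V) (hlegs : AreLegs G v legs)
    (S : Set V) (hvS : v ∈ S) :
    IsConsistent G col S ↔
      ∀ i : Fin k,
        IsConsistent (G.induce (legs i ∪ {v})) (fun x => col x.1)
          {x : ↥(legs i ∪ {v}) | (x : V) ∈ S ∩ legs i ∪ {v}} := by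
  have hG : G.Connected := hsp.1.connected
  constructor
  · rintro hS i ⟨x, hx⟩ hxC
    have hxi : x ∈ legs i := hx.resolve_right fun hxv => hxC (Or.inr hxv)
    obtain ⟨u, huS, hcol, hu⟩ := hS x fun hxS => hxC (Or.inl ⟨hxS, hxi⟩)
    have huA : u ∈ legs i ∪ {v} := by
      by_contra huA
      exact absurd (hu v hvS) (hlegs.dist_center_lt hG hxi huA).not_ge
    refine ⟨⟨u, huA⟩, huA.imp (fun hui => ⟨huS, hui⟩) id, hcol, fun w hw => ?_⟩
    rw [hlegs.dist_induce hG, hlegs.dist_induce hG]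
    rcases hw with hw | hw
    · exact hu w hw.1
    · exact hu w (by rwa [Set.mem_singleton_iff.1 hw])
  · intro hS x hxS
    have hxmem : x ∈ ⋃ j, legs j := by
      rw [hlegs.1]
      rintro rfl
      exact hxS hvS
    obtain ⟨i, hxi⟩ := Set.mem_iUnion.1 hxmem
    have hxC : (⟨x, Or.inl hxi⟩ : ↥(legs i ∪ {v})) ∉
        {x : ↥(legs i ∪ {v}) | (x : V) ∈ S ∩ legs i ∪ {v}} := by
      rintro (hx | hx)
      · exact hxS hx.1
      · exact hxS ((show x = v from hx) ▸ hvS)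
    obtain ⟨⟨u, huA⟩, huC, hcol, hu⟩ := hS i _ hxC
    have huS : u ∈ S := by
      rcases huC with hu' | hu'
      · exact hu'.1
      · rwa [show u = v from hu']
    have hdist : ∀ w (hw : w ∈ legs i ∪ {v}), w ∈ S → G.dist x u ≤ G.dist x w := by
      intro w hw hwS
      have := hu ⟨w, hw⟩ (hw.imp (fun hwi => ⟨hwS, hwi⟩) id)
      rwa [hlegs.dist_induce hG, hlegs.dist_induce hG] at this
    refine ⟨u, huS, hcol, fun w hwS => ?_⟩
    by_cases hw : w ∈ legs i ∪ {v}
    · exact hdist w hw hwS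
    · exact (hdist v (Or.inr rfl) hvS).trans (hlegs.dist_center_lt hG hxi hw).le
end

section
/- Let G be a spider with center v and legs V_1,…,V_{k_1}, and suppose every neighbour of v has a colour different from col(v). For each i let m_i be the minimum cardinality of a consistent subset of the path induced on V_i ∪ {v} among those consistent subsets that contain v. Then the minimum cardinality of a consistent subset of G equals 1 + Σ_{i=1}^{k_1} (m_i − 1). -/
/-- In an acyclic graph, distances inside a connected induced subgraph agree with distances in the
whole graph. -/
lemma SimpleGraph.IsAcyclic.dist_induce {V : Type*} {G : SimpleGraph V} (hG : G.IsAcyclic)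
    {s : Set V} (hs : (G.induce s).Connected) (x y : s) :
    (G.induce s).dist x y = G.dist x y := by
  obtain ⟨p, hp, hpl⟩ := hs.exists_path_of_dist x y
  let f := (SimpleGraph.Embedding.induce (G := G) s).toHom
  have hp' : (p.map f).IsPath := hp.map Subtype.val_injective
  obtain ⟨q, hq, hql⟩ := (p.map f).reachable.exists_path_of_dist
  have h := congrArg (fun r => r.1.length)
    ((hG.subsingleton_path _ _).elim ⟨p.map f, hp'⟩ ⟨q, hq⟩)
  simp only [SimpleGraph.Walk.length_map] at h
  exact hpl.symm.trans (h.trans hql)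

/-- If `v` is the only vertex outside `s` adjacent to a vertex of `s`, then it lies on a geodesic
from each vertex of `s` to each vertex outside `s`. -/
lemma SimpleGraph.Connected.dist_eq_add_of_separates {V : Type*} {G : SimpleGraph V}
    (hG : G.Connected) {s : Set V} {v : V} (hs : ∀ a ∈ s, ∀ b ∉ s, G.Adj a b → b = v)
    {x y : V} (hx : x ∈ s) (hy : y ∉ s) : G.dist x y = G.dist x v + G.dist v y := by
  classical
  obtain ⟨p, hp⟩ := hG.exists_walk_length_eq_dist x y
  obtain ⟨d, hd, hd₁, hd₂⟩ := p.exists_boundary_dart s hx hy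
  have hv : v ∈ p.support := hs _ hd₁ _ hd₂ d.adj ▸ p.dart_snd_mem_support_of_mem_darts hd
  have hlen := congrArg SimpleGraph.Walk.length (p.take_spec hv)
  rw [SimpleGraph.Walk.length_append] at hlen
  have h₁ := SimpleGraph.dist_le (p.takeUntil v hv)
  have h₂ := SimpleGraph.dist_le (p.dropUntil v hv)
  have h₃ := hG.dist_triangle (u := x) (v := v) (w := y)
  omega

/-- The first step of a geodesic. -/
lemma SimpleGraph.Connected.exists_adj_dist_eq {V : Type*} {G : SimpleGraph V}
    (hG : G.Connected) {x y : V} {n : ℕ} (h : G.dist x y = n + 1) :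
    ∃ w, G.Adj x w ∧ G.dist w y = n := by
  obtain ⟨p, hp⟩ := hG.exists_walk_length_eq_dist x y
  cases p with
  | nil => simp at h
  | @cons _ w _ hw q =>
    refine ⟨w, hw, ?_⟩
    have h₁ := SimpleGraph.dist_le q
    have h₂ := hG.dist_triangle (u := x) (v := w) (w := y)
    rw [SimpleGraph.dist_eq_one_iff_adj.2 hw] at h₂
    rw [SimpleGraph.Walk.length_cons] at hp
    omega

/-- If every vertex other than `v` has degree at most `2`, geodesics with a common first edge
`a b` and the same length have the same endpoint, as long as they do not reach `v` after `a`. -/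
lemma eq_of_dist_eq_of_degree_le_two {V : Type*} [Fintype V] {G : SimpleGraph V}
    [DecidableRel G.Adj] (hG : G.Connected) {v : V} (hdeg : ∀ w : V, w ≠ v → G.degree w ≤ 2)
    {u u' : V} {n : ℕ} {a b : V} (hab : G.Adj a b) (hv : n < G.dist v u)
    (hb : G.dist b u = n) (hb' : G.dist b u' = n)
    (ha : G.dist a u = n + 1) (ha' : G.dist a u' = n + 1) : u = u' := by
  induction n generalizing a b with
  | zero => exact (hG.dist_eq_zero_iff.1 hb).symm.trans (hG.dist_eq_zero_iff.1 hb')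
  | succ n ih =>
    obtain ⟨c, hbc, hc⟩ := hG.exists_adj_dist_eq hb
    obtain ⟨c', hbc', hc'⟩ := hG.exists_adj_dist_eq hb'
    have hbv : b ≠ v := by rintro rfl; omega
    have hac : a ≠ c := by rintro rfl; omega
    have hac' : a ≠ c' := by rintro rfl; omega
    have hcc : c = c' := by
      by_contra hne
      refine (hdeg b hbv).not_gt (Finset.two_lt_card_iff.2 ⟨a, c, c', ?_, ?_, ?_, hac, hac', hne⟩)
        <;> simp [hab.symm, hbc, hbc']
    exact ih hbc (by omega) hc (hcc ▸ hc') hb hb'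

/-- A consistent subset of a spider contains the center if no neighbour of the center has its
colour. -/
lemma IsConsistent.center_mem {V κ : Type*} [Fintype V] {G : SimpleGraph V}
    [DecidableRel G.Adj] {col : V → κ} {v : V} (hsp : IsSpider G v)
    (hcol : ∀ w : V, G.Adj v w → col w ≠ col v) {C : Set V} (hC : IsConsistent G col C) :
    v ∈ C := by
  by_contra hv
  have hG := hsp.1.connected
  obtain ⟨u, hu, huv, hmin⟩ := hC v hv
  have hpos := hG.pos_dist_of_ne (show v ≠ u by rintro rfl; exact hv hu)
  obtain ⟨n, hn⟩ : ∃ n, G.dist v u = n + 1 := ⟨_, (Nat.succ_pred_eq_of_pos hpos).symm⟩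
  obtain ⟨w, hvw, hw⟩ := hG.exists_adj_dist_eq hn
  have hvw₁ := SimpleGraph.dist_eq_one_iff_adj.2 hvw
  have hwC : w ∉ C := by
    intro hwC
    have hle := hmin w hwC
    have hwu : w = u := hG.dist_eq_zero_iff.1 (by omega)
    exact hcol w hvw (hwu ▸ huv)
  obtain ⟨u', hu', hwu', hmin'⟩ := hC w hwC
  have h₁ := hmin' u hu
  have h₂ := hmin u' hu'
  have h₃ := hG.dist_triangle (u := v) (v := w) (w := u')
  have huu := eq_of_dist_eq_of_degree_le_two hG hsp.2 (u' := u') hvw (by omega) hw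
    (by omega) hn (by omega)
  exact hcol w hvw (by rw [← hwu', ← huu, huv])

namespace AreLegs

variable {V κ : Type*} {G : SimpleGraph V} {v : V} {k : ℕ} {legs : Fin k → Set V}

lemma center_notMem (h : AreLegs G v legs) (i : Fin k) : v ∉ legs i := fun hv =>
  (h.1 ▸ Set.mem_iUnion_of_mem i hv : v ∈ ({v} : Set V)ᶜ) rfl

lemma exists_mem (h : AreLegs G v legs) {x : V} (hx : x ≠ v) : ∃ i, x ∈ legs i :=
  Set.mem_iUnion.1 (h.1 ▸ hx)

lemma eq_of_mem (h : AreLegs G v legs) {x : V} {i j : Fin k} (hi : x ∈ legs i)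
    (hj : x ∈ legs j) : i = j :=
  by_contra fun hij => (Set.disjoint_left.1 (h.2.1 i j hij)) hi hj

lemma eq_center_of_adj (h : AreLegs G v legs) (i : Fin k) :
    ∀ a ∈ legs i, ∀ b ∉ legs i, G.Adj a b → b = v := by
  intro a ha b hb hab
  by_contra hbv
  obtain ⟨j, hj⟩ := h.exists_mem hbv
  exact h.2.2.2 i j (by rintro rfl; exact hb hj) a ha b hj hab

lemma connected_induce_union_center (hG : G.Connected) (h : AreLegs G v legs) (i : Fin k) :
    (G.induce (legs i ∪ {v})).Connected := by
  obtain ⟨x, hx⟩ := (h.2.2.1 i).nonempty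
  obtain ⟨p⟩ := hG x v
  obtain ⟨d, -, hd₁, hd₂⟩ := p.exists_boundary_dart (legs i) hx (h.center_notMem i)
  have hd := h.eq_center_of_adj i _ hd₁ _ hd₂ d.adj
  exact SimpleGraph.connected_induce_union (h.2.2.1 i).preconnected
    SimpleGraph.Connected.of_subsingleton.preconnected hd₁ rfl (hd ▸ d.adj)

/-- A set containing the center is consistent exactly when its restriction to each leg, with the
center added, is. -/
lemma isConsistent_iff (hG : G.IsTree) (h : AreLegs G v legs) (col : V → κ) {C : Set V}
    (hv : v ∈ C) :
    IsConsistent G col C ↔ ∀ i, IsConsistent (G.induce (legs i ∪ {v})) (fun x => col x.1)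
      ((↑) ⁻¹' C : Set ↥(legs i ∪ {v})) := by
  have hdist (i : Fin k) :=
    hG.isAcyclic.dist_induce (h.connected_induce_union_center hG.connected i)
  have hsep (i : Fin k) {x y : V} (hx : x ∈ legs i) (hy : y ∉ legs i) :=
    hG.connected.dist_eq_add_of_separates (h.eq_center_of_adj i) hx hy
  constructor
  · rintro hC i ⟨x, hx⟩ hxC
    obtain ⟨u, hu, hux, hmin⟩ := hC x hxC
    have hxv : x ≠ v := by rintro rfl; exact hxC hv
    have hxi : x ∈ legs i := hx.resolve_right hxv
    have hui : u ∈ legs i ∪ {v} := by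
      by_contra hui
      rw [Set.mem_union, not_or] at hui
      have h₁ := hsep i hxi hui.1
      have h₂ := hmin v hv
      have h₃ := hG.connected.pos_dist_of_ne (Ne.symm hui.2)
      omega
    refine ⟨⟨u, hui⟩, hu, hux, fun w hw => ?_⟩
    rw [hdist, hdist]
    exact hmin w hw
  · intro hC x hxC
    have hxv : x ≠ v := by rintro rfl; exact hxC hv
    obtain ⟨i, hi⟩ := h.exists_mem hxv
    obtain ⟨u, hu, hux, hmin⟩ := hC i ⟨x, Or.inl hi⟩ hxC
    refine ⟨u, hu, hux, fun w hw => ?_⟩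
    have hle (y : ↥(legs i ∪ {v})) (hy : y.1 ∈ C) : G.dist x u ≤ G.dist x y := by
      simpa only [hdist] using hmin y hy
    by_cases hwi : w ∈ legs i
    · exact hle ⟨w, Or.inl hwi⟩ hw
    · have h₁ := hsep i hi hwi
      have h₂ := hle ⟨v, Or.inr rfl⟩ hv
      dsimp only at h₂
      omega

/-- The cardinality of a set containing the center, in terms of its restrictions to the legs. -/
lemma ncard_eq [Finite V] (h : AreLegs G v legs) {C : Set V} (hv : v ∈ C) :
    C.ncard = 1 + ∑ i, (((↑) ⁻¹' C : Set ↥(legs i ∪ {v})).ncard - 1) := by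
  have hleg (i : Fin k) :
      ((↑) ⁻¹' C : Set ↥(legs i ∪ {v})).ncard - 1 = (C ∩ legs i).ncard := by
    have himg : (Subtype.val '' ((↑) ⁻¹' C : Set ↥(legs i ∪ {v}))) = insert v (C ∩ legs i) := by
      ext x
      rw [Subtype.image_preimage_coe]
      simp only [Set.mem_inter_iff, Set.mem_union, Set.mem_singleton_iff, Set.mem_insert_iff]
      constructor
      · tauto
      · rintro (rfl | hx)
        · exact ⟨Or.inr rfl, hv⟩
        · exact ⟨Or.inl hx.2, hx.1⟩
    rw [← Set.ncard_image_of_injective _ Subtype.val_injective, himg,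
      Set.ncard_insert_of_notMem fun hx => h.center_notMem i hx.2, Nat.add_sub_cancel]
  have hC : C = insert v (⋃ i, C ∩ legs i) := by
    rw [← Set.inter_iUnion, h.1]
    ext x
    by_cases hx : x = v <;> simp [hx, hv]
  have hun : v ∉ ⋃ i, C ∩ legs i := by
    simp [h.center_notMem]
  simp only [hleg]
  nth_rewrite 1 [hC]
  rw [Set.ncard_insert_of_notMem hun, Set.ncard_iUnion_of_finite (fun _ => Set.toFinite _),
    finsum_eq_sum_of_fintype, add_comm]
  exact fun i j hij => (h.2.1 i j hij).mono Set.inter_subset_right Set.inter_subset_right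

end AreLegs

/-- Let `G` be a spider with center `v` and legs `legs`, where every neighbour of
`v` has a colour different from `col v`. If `m i` is the minimum cardinality of a
consistent subset containing `v` of the path induced on `V_i ∪ {v}`, then the
minimum cardinality of a consistent subset of `G` is `1 + Σ_i (m i − 1)`. -/
theorem minCS_spider_case_one
    {V κ : Type*} [Fintype V] (G : SimpleGraph V) [DecidableRel G.Adj]
    (col : V → κ) (v : V) (hsp : IsSpider G v)
    {k : ℕ} (legs : Fin k → Set V) (hlegs : AreLegs G v legs)
    (hcol : ∀ w : V, G.Adj v w → col w ≠ col v)
    (m : Fin k → ℕ)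
    (hm : ∀ i : Fin k,
      IsLeast {t : ℕ | ∃ S : Set ↥(legs i ∪ {v}),
        IsConsistent (G.induce (legs i ∪ {v})) (fun x => col x.1) S ∧
        (⟨v, Set.mem_union_right _ rfl⟩ : ↥(legs i ∪ {v})) ∈ S ∧
        S.ncard = t} (m i)) :
    IsLeast {t : ℕ | ∃ C : Set V, IsConsistent G col C ∧ C.ncard = t}
      (1 + ∑ i : Fin k, (m i - 1)) := by
  constructor
  · choose S hS hvS hSm using fun i => (hm i).1
    let C : Set V := insert v (⋃ i, Subtype.val '' S i)
    have hv : v ∈ C := Set.mem_insert _ _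
    have hpre (i : Fin k) : ((↑) ⁻¹' C : Set ↥(legs i ∪ {v})) = S i := by
      ext ⟨x, hx⟩
      constructor
      · intro hxC
        by_cases hxv : x = v
        · subst hxv
          exact hvS i
        · obtain ⟨j, ⟨y, hy⟩, hyS, rfl⟩ := Set.mem_iUnion.1 (Set.mem_of_mem_insert_of_ne hxC hxv)
          obtain rfl := hlegs.eq_of_mem (hx.resolve_right hxv) (hy.resolve_right hxv)
          exact hyS
      · exact fun hxS => Or.inr (Set.mem_iUnion_of_mem i ⟨_, hxS, rfl⟩)
    refine ⟨C, (hlegs.isConsistent_iff hsp.1 col hv).2 fun i => ?_, ?_⟩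
    · rw [hpre]
      exact hS i
    · simp only [hlegs.ncard_eq hv, hpre, hSm]
  · rintro t ⟨C, hC, rfl⟩
    have hv := hC.center_mem hsp hcol
    rw [hlegs.ncard_eq hv]
    gcongr with i
    exact (hm i).2 ⟨_, (hlegs.isConsistent_iff hsp.1 col hv).1 hC i, hv, rfl⟩
end

section
/- Let G be a spider with center v and legs V_1,…,V_{k_1}. Let I ⊆ {1,…,k_1}, let d ≥ 1, and for each i ∈ I let p_i be the vertex of leg V_i at distance d from v; assume every colour that appears on a vertex of V ∖ ⋃_{i∈I} V_i appears among the colours {col(p_i) : i ∈ I}. Let S be a set of vertices with S ⊆ ⋃_{i∈I} V_i, p_i ∈ S for every i ∈ I, and dist(v,s) ≥ d for every s ∈ S. Then every vertex w ∈ V ∖ ⋃_{i∈I} V_i satisfies the consistency condition with respect to S: there exists u ∈ S with col(u) = col(w) and dist(w,u) ≤ dist(w,s) for all s ∈ S. -/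
/-- A walk entering a set `A` from outside meets `v`, if every edge entering `A` starts at `v`. -/
theorem SimpleGraph.Walk.mem_support_of_enters {V : Type*} {G : SimpleGraph V} {v : V} {A : Set V}
    (hA : ∀ a ∉ A, ∀ b ∈ A, G.Adj a b → a = v) {a b : V} (q : G.Walk a b)
    (ha : a ∉ A) (hb : b ∈ A) : v ∈ q.support := by
  obtain ⟨e, he, h₁, h₂⟩ := q.exists_boundary_dart Aᶜ ha (not_not_intro hb)
  rw [← hA _ h₁ _ (not_not.mp h₂) e.adj]
  exact q.dart_fst_mem_support_of_mem_darts he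

/-- An edge entering a leg from outside starts at the center. -/
theorem AreLegs.eq_center_of_adj_s6 {V : Type*} {G : SimpleGraph V} {v : V} {k : ℕ}
    {legs : Fin k → Set V} (h : AreLegs G v legs) {j : Fin k} {a b : V}
    (ha : a ∉ legs j) (hb : b ∈ legs j) (hab : G.Adj a b) : a = v := by
  by_contra hav
  have : a ∈ ⋃ i, legs i := h.1 ▸ hav
  obtain ⟨i, hi⟩ := Set.mem_iUnion.mp this
  exact h.2.2.2 i j (fun hij => ha (hij ▸ hi)) a hi b hb hab

/-- A vertex on every walk between two vertices of a connected graph splits their distance. -/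
theorem SimpleGraph.Connected.dist_add_dist_le {V : Type*} {G : SimpleGraph V}
    (hG : G.Connected) {a b v : V} (h : ∀ q : G.Walk a b, v ∈ q.support) :
    G.dist a v + G.dist v b ≤ G.dist a b := by
  classical
  obtain ⟨q, hq⟩ := hG.exists_walk_length_eq_dist a b
  rw [← hq, ← congrArg SimpleGraph.Walk.length (q.take_spec (h q)), SimpleGraph.Walk.length_append]
  exact add_le_add (SimpleGraph.dist_le _) (SimpleGraph.dist_le _)

/-- Let `G` be a spider with center `v` and legs `legs`, `I` a set of legs, `d ≥ 1`,
and for each `i ∈ I` let `p i` be the vertex of leg `i` at distance `d` from `v`.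
Suppose every colour appearing outside `⋃_{i∈I} V_i` appears among the `col (p i)`.
If `S ⊆ ⋃_{i∈I} V_i` contains every `p i` and every vertex of `S` is at distance
at least `d` from `v`, then every vertex outside `⋃_{i∈I} V_i` satisfies the
consistency condition with respect to `S`. -/
theorem gates_cover_outside_vertices
    {V κ : Type*} [Fintype V] (G : SimpleGraph V) [DecidableRel G.Adj]
    (col : V → κ) (v : V) (hsp : IsSpider G v)
    {k : ℕ} (legs : Fin k → Set V) (hlegs : AreLegs G v legs)
    (I : Set (Fin k)) (d : ℕ) (hd : 1 ≤ d)
    (p : Fin k → V) (hp : ∀ i ∈ I, p i ∈ legs i ∧ G.dist v (p i) = d)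
    (hcover : ∀ w : V, w ∉ ⋃ i ∈ I, legs i → ∃ i ∈ I, col (p i) = col w)
    (S : Set V) (hS : S ⊆ ⋃ i ∈ I, legs i)
    (hpS : ∀ i ∈ I, p i ∈ S)
    (hdist : ∀ s ∈ S, d ≤ G.dist v s) :
    ∀ w : V, w ∉ ⋃ i ∈ I, legs i →
      ∃ u ∈ S, col u = col w ∧ ∀ s ∈ S, G.dist w u ≤ G.dist w s := by
  intro w hw
  obtain ⟨i, hi, hcol⟩ := hcover w hw
  refine ⟨p i, hpS i hi, hcol, fun s hs => ?_⟩
  obtain ⟨j, hj, hsj⟩ := Set.mem_iUnion₂.mp (hS hs)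
  have hwj : w ∉ legs j := fun h => hw (Set.mem_biUnion hj h)
  calc G.dist w (p i) ≤ G.dist w v + G.dist v (p i) := hsp.1.connected.dist_triangle
    _ ≤ G.dist w v + G.dist v s := by
      rw [(hp i hi).2]
      exact Nat.add_le_add_left (hdist s hs) _
    _ ≤ G.dist w s := hsp.1.connected.dist_add_dist_le fun q =>
      q.mem_support_of_enters (fun _ ha _ hb => hlegs.eq_center_of_adj_s6 ha hb) hwj hsj
end

section
/- Let G be a spider with center v, and let C be a consistent subset of G with v ∉ C. Then C contains at least one vertex u belonging to the first run ρ_j of some leg V_j (that is, C ∩ ⋃_{i=1}^{k_1} ρ_i ≠ ∅). -/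
namespace SimpleGraph

variable {V : Type*} {G : SimpleGraph V}

/-- A vertex at positive distance from `b` has a neighbour one step closer to `b`. -/
theorem Connected.exists_adj_dist_eq_s7 (hG : G.Connected) {a b : V} {n : ℕ}
    (h : G.dist a b = n + 1) : ∃ y, G.Adj a y ∧ G.dist y b = n := by
  obtain ⟨p, hp⟩ := hG.exists_walk_length_eq_dist a b
  cases p with
  | nil => simp at h
  | @cons _ y _ hay q =>
    refine ⟨y, hay, ?_⟩
    have h1 := dist_le q
    have h2 := hG.dist_triangle (u := a) (v := y) (w := b)
    rw [dist_eq_one_iff_adj.mpr hay] at h2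
    rw [Walk.length_cons] at hp
    omega

/-- If all vertices other than `v` have degree at most `2`, geodesics from `v` do not branch:
two vertices at the same distance beyond `x ≠ v` coincide. -/
theorem Connected.eq_of_dist_add_eq [Fintype V] [DecidableRel G.Adj] (hG : G.Connected) {v : V}
    (hdeg : ∀ w, w ≠ v → G.degree w ≤ 2) (n : ℕ) {x u w : V} (hx : x ≠ v)
    (hu : G.dist x u = n) (hw : G.dist x w = n)
    (hvu : G.dist v u = G.dist v x + n) (hvw : G.dist v w = G.dist v x + n) : u = w := by
  classical
  induction n generalizing x with
  | zero => exact (hG.dist_eq_zero_iff.mp hu).symm.trans (hG.dist_eq_zero_iff.mp hw)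
  | succ n ih =>
    have away : ∀ {t : V}, G.dist x t = n + 1 → G.dist v t = G.dist v x + (n + 1) →
        ∃ y, G.Adj x y ∧ G.dist y t = n ∧ G.dist v y = G.dist v x + 1 := by
      intro t ht hvt
      obtain ⟨y, hxy, hyt⟩ := hG.exists_adj_dist_eq_s7 ht
      refine ⟨y, hxy, hyt, ?_⟩
      have h1 := hG.dist_triangle (u := v) (v := x) (w := y)
      have h2 := hG.dist_triangle (u := v) (v := y) (w := t)
      rw [dist_eq_one_iff_adj.mpr hxy] at h1
      omega
    obtain ⟨y, hxy, hyu, hvy⟩ := away hu hvu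
    obtain ⟨y', hxy', hyw, hvy'⟩ := away hw hvw
    have hpos := hG.pos_dist_of_ne hx
    obtain ⟨z, hxz, hzv⟩ := hG.exists_adj_dist_eq_s7 (Nat.succ_pred_eq_of_pos hpos).symm
    rw [Nat.pred_eq_sub_one, dist_comm, dist_comm (u := x)] at hzv
    rw [dist_comm] at hpos
    have hzy : z ≠ y := by rintro rfl; omega
    have hzy' : z ≠ y' := by rintro rfl; omega
    have hyy' : y = y' := by
      by_contra hne
      have hsub : ({z, y, y'} : Finset V) ⊆ G.neighborFinset x := by
        intro t ht
        simp only [Finset.mem_insert, Finset.mem_singleton] at ht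
        rcases ht with rfl | rfl | rfl <;> simpa
      have hcard := Finset.card_le_card hsub
      rw [Finset.card_eq_three.mpr ⟨z, y, y', hzy, hzy', hne, rfl⟩, card_neighborFinset_eq_degree]
        at hcard
      have := hdeg x hx
      omega
    subst hyy'
    have hyv : y ≠ v := by rintro rfl; simp at hvy
    exact ih hyv hyu hyw (by omega) (by omega)

/-- Paths in a tree are geodesics. -/
theorem IsTree.length_eq_dist_of_isPath (hG : G.IsTree) {a b : V} {p : G.Walk a b}
    (hp : p.IsPath) : p.length = G.dist a b := by
  obtain ⟨q, hq, hlen⟩ := hG.connected.exists_path_of_dist a b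
  rw [← hlen, (hG.existsUnique_path a b).unique hp hq]

end SimpleGraph


/-- If `C` is a consistent subset of a spider `G` with center `v` and `v ∉ C`,
then `C` contains at least one vertex belonging to the first run of some leg. -/
theorem consistent_meets_first_runs
    {V κ : Type*} [Fintype V] (G : SimpleGraph V) [DecidableRel G.Adj]
    (col : V → κ) (v : V) (hsp : IsSpider G v)
    (C : Set V) (hC : IsConsistent G col C) (hv : v ∉ C) :
    ∃ u ∈ C, InFirstRun G col v u := by
  classical
  have hG := hsp.1.connected
  obtain ⟨u, huC, -, hmin⟩ := hC v hv
  refine ⟨u, huC, fun h => hv (h ▸ huC), fun p hp x hxp hxv => ?_⟩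
  have hlen := hsp.1.length_eq_dist_of_isPath hp
  have hsplit := congrArg SimpleGraph.Walk.length (p.take_spec hxp)
  rw [SimpleGraph.Walk.length_append] at hsplit
  have h1 := SimpleGraph.dist_le (p.takeUntil x hxp)
  have h2 := SimpleGraph.dist_le (p.dropUntil x hxp)
  have h3 := hG.dist_triangle (u := v) (v := x) (w := u)
  by_cases hxC : x ∈ C
  · have h4 := hmin x hxC
    rw [hG.dist_eq_zero_iff.mp (show G.dist x u = 0 by omega)]
  · obtain ⟨w, hwC, hcol, hnear⟩ := hC x hxC
    have h4 := hnear u huC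
    have h5 := hmin w hwC
    have h6 := hG.dist_triangle (u := v) (v := x) (w := w)
    rw [← hcol, hG.eq_of_dist_add_eq (u := u) (w := w) hsp.2 (G.dist x u) hxv rfl
      (by omega) (by omega) (by omega)]
end

section
/- Let G be a finite connected vertex-coloured graph and let P = (p_1,…,p_t) be a pendant monochromatic path in G: all vertices of P have the same colour, the vertices p_2,…,p_t have no neighbours outside P, and p_1 has exactly one neighbour outside P. Let M be a consistent subset of G containing two distinct vertices x, y of P, where x is closer to p_1 than y is. Then M ∖ {y} is again a consistent subset of G. -/
/-- `p` enumerates a pendant monochromatic path `(p 0, …, p t)` of `G`: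
the vertices are distinct, two of them are adjacent exactly when they are
consecutive, all have the same colour, the vertices `p 1, …, p t` have no
neighbours outside the path, and `p 0` has exactly one neighbour outside it. -/
def IsPendantMonoPath {V κ : Type*} (G : SimpleGraph V) (col : V → κ)
    {t : ℕ} (p : Fin (t + 1) → V) : Prop :=
  Function.Injective p ∧
  (∀ i j : Fin (t + 1), G.Adj (p i) (p j) ↔ ((i : ℕ) + 1 = j ∨ (j : ℕ) + 1 = i)) ∧
  (∀ i j : Fin (t + 1), col (p i) = col (p j)) ∧
  (∀ i : Fin (t + 1), 0 < (i : ℕ) → ∀ w : V, G.Adj (p i) w → ∃ j, w = p j) ∧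
  (∃! w : V, G.Adj (p 0) w ∧ ∀ j, w ≠ p j)

/-- A walk from a vertex `p i` with `a ≤ i` to a vertex that is not beyond `p a` on the pendant
path is at least as long as the detour through `p a`. -/
theorem IsPendantMonoPath.dist_add_le_length {V κ : Type*} {G : SimpleGraph V} {col : V → κ}
    {t : ℕ} {p : Fin (t + 1) → V} (hp : IsPendantMonoPath G col p) (a : Fin (t + 1)) {x w : V}
    (q : G.Walk x w) (hw : ∀ j, a < j → w ≠ p j) (i : Fin (t + 1)) (hi : a ≤ i) (hx : x = p i) :
    G.dist (p a) w + ((i : ℕ) - a) ≤ q.length := by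
  induction q generalizing i with
  | nil =>
    obtain rfl : i = a := le_antisymm (not_lt.1 fun h => hw i h hx) hi
    simp [hx]
  | @cons x y w h q ih =>
    subst hx
    rcases hi.eq_or_lt with rfl | hlt
    · simpa using SimpleGraph.dist_le (SimpleGraph.Walk.cons h q)
    · have hpos : 0 < (i : ℕ) := by omega
      obtain ⟨j, rfl⟩ := hp.2.2.2.1 i hpos y h
      have hij := (hp.2.1 i j).1 h
      have := ih hw j (by omega) rfl
      rw [SimpleGraph.Walk.length_cons]
      omega

/-- The distance between two vertices of a pendant path is at most their distance along it. -/
theorem IsPendantMonoPath.dist_le_sub {V κ : Type*} {G : SimpleGraph V} (hG : G.Connected)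
    {col : V → κ} {t : ℕ} {p : Fin (t + 1) → V} (hp : IsPendantMonoPath G col p)
    (a : Fin (t + 1)) (n : ℕ) (hn : a + n < t + 1) :
    G.dist (p a) (p ⟨a + n, hn⟩) ≤ n := by
  induction n with
  | zero => simp
  | succ n ih =>
    have hadj : G.Adj (p ⟨a + n, by omega⟩) (p ⟨a + (n + 1), hn⟩) :=
      (hp.2.1 _ _).2 (Or.inl rfl)
    have htri := hG.dist_triangle (u := p a) (v := p ⟨a + n, by omega⟩)
      (w := p ⟨a + (n + 1), hn⟩)
    rw [SimpleGraph.dist_eq_one_iff_adj.2 hadj] at htri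
    have := ih (by omega)
    omega

/-- If a consistent subset `M` of a finite connected coloured graph contains two
distinct vertices `p a`, `p b` of a pendant monochromatic path, with `p a` closer
to the attachment end, then removing the farther one, `p b`, from `M` again
yields a consistent subset. -/
theorem remove_far_vertex_of_pendant_path
    {V κ : Type*} [Fintype V] (G : SimpleGraph V) (hG : G.Connected)
    (col : V → κ) {t : ℕ} (p : Fin (t + 1) → V) (hp : IsPendantMonoPath G col p)
    (M : Set V) (hM : IsConsistent G col M)
    (a b : Fin (t + 1)) (hab : a < b) (ha : p a ∈ M) (hb : p b ∈ M) :
    IsConsistent G col (M \ {p b}) := by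
  intro v hv
  have ha' : p a ∈ M \ {p b} := ⟨ha, fun h => hab.ne (hp.1 h)⟩
  have key (w : V) (hw : ∀ j, a < j → w ≠ p j) (i : Fin (t + 1)) (hi : a ≤ i) :
      G.dist (p a) w + ((i : ℕ) - a) ≤ G.dist (p i) w := by
    obtain ⟨q, hq⟩ := hG.exists_walk_length_eq_dist (p i) w
    exact hq ▸ hp.dist_add_le_length a q hw i hi rfl
  by_cases hvp : ∃ i, a < i ∧ v = p i
  · obtain ⟨i, hi, rfl⟩ := hvp
    obtain ⟨u, hu, hmin⟩ :=
      Set.exists_min_image (M \ {p b}) (G.dist (p i)) (Set.toFinite _) ⟨_, ha'⟩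
    by_cases hup : ∃ j, u = p j
    · obtain ⟨j, rfl⟩ := hup
      exact ⟨p j, hu, hp.2.2.1 j i, hmin⟩
    · refine ⟨p a, ha', hp.2.2.1 a i, fun w hw => le_trans ?_ (hmin w hw)⟩
      have h1 := key u (fun j _ h => hup ⟨j, h⟩) i hi.le
      have h2 := hp.dist_le_sub hG a (i - a) (by omega)
      have h3 : (⟨a + (i - a), by omega⟩ : Fin (t + 1)) = i := by ext; simp; omega
      rw [h3, G.dist_comm] at h2
      omega
  · push Not at hvp
    obtain ⟨u, hu, hcol, hmin⟩ := hM v fun h => hv ⟨h, hvp b hab⟩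
    refine ⟨u, ⟨hu, ?_⟩, hcol, fun w hw => hmin w hw.1⟩
    rintro rfl
    have h1 := key v hvp b hab.le
    have h2 := hmin _ ha
    rw [G.dist_comm, G.dist_comm (u := p b)] at h1
    omega
end

section
/- Let G be a finite connected vertex-coloured graph and let P = (p_1,…,p_t) be a pendant monochromatic path in G: all vertices of P have the same colour, the vertices p_2,…,p_t have no neighbours outside P, and p_1 has exactly one neighbour outside P. Then every minimum consistent subset M of G contains at most one vertex of P. -/
/-- `M` is a minimum consistent subset: a consistent subset of minimum cardinality. -/
def IsMinConsistent {V κ : Type*} (G : SimpleGraph V) (col : V → κ) (M : Set V) : Prop :=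
  IsConsistent G col M ∧ ∀ C : Set V, IsConsistent G col C → M.ncard ≤ C.ncard

/-- If every edge leaving `S` ends at `c`, then a walk from `S` to its complement
passes through `c`. -/
theorem SimpleGraph.Connected.dist_add_dist_le_length_of_separates {V : Type*}
    {G : SimpleGraph V} (hG : G.Connected) {S : Set V} {c : V}
    (hS : ∀ x ∈ S, ∀ y, G.Adj x y → y ∈ S ∨ y = c) {v w : V} (q : G.Walk v w)
    (hv : v ∈ S) (hw : w ∉ S) : G.dist v c + G.dist c w ≤ q.length := by
  induction q with
  | nil => exact absurd hv hw
  | @cons x y z h q ih =>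
    have hxy : G.dist x y = 1 := SimpleGraph.dist_eq_one_iff_adj.mpr h
    rw [SimpleGraph.Walk.length_cons]
    rcases hS x hv y h with hy | rfl
    · have := ih hy hw
      have := hG.dist_triangle (u := x) (v := y) (w := c)
      omega
    · have := SimpleGraph.dist_le q
      omega

/-- If every edge leaving `S` ends at `c`, then a geodesic from `S` to its complement
passes through `c`. -/
theorem SimpleGraph.Connected.dist_add_dist_le_of_separates {V : Type*}
    {G : SimpleGraph V} (hG : G.Connected) {S : Set V} {c : V}
    (hS : ∀ x ∈ S, ∀ y, G.Adj x y → y ∈ S ∨ y = c) {v w : V}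
    (hv : v ∈ S) (hw : w ∉ S) : G.dist v c + G.dist c w ≤ G.dist v w := by
  obtain ⟨q, hq⟩ := hG.exists_walk_length_eq_dist v w
  exact hq ▸ hG.dist_add_dist_le_length_of_separates hS q hv hw

/-- A consistent subset containing `c` stays consistent after deleting a set of vertices
of the colour of `c` that `c` separates from the rest of the graph. -/
theorem IsConsistent.diff_of_separates {V κ : Type*} {G : SimpleGraph V} (hG : G.Connected)
    {col : V → κ} {M S : Set V} {c : V} (hM : IsConsistent G col M) (hcM : c ∈ M)
    (hcS : c ∉ S) (hS : ∀ x ∈ S, ∀ y, G.Adj x y → y ∈ S ∨ y = c)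
    (hcol : ∀ x ∈ S, col c = col x) : IsConsistent G col (M \ S) := by
  intro v hv
  by_cases hvS : v ∈ S
  · refine ⟨c, ⟨hcM, hcS⟩, hcol v hvS, fun w hw => ?_⟩
    exact le_of_add_le_left (hG.dist_add_dist_le_of_separates hS hvS hw.2)
  · obtain ⟨u, huM, hu, hmin⟩ := hM v fun h => hv ⟨h, hvS⟩
    refine ⟨u, ⟨huM, fun huS => ?_⟩, hu, fun w hw => hmin w hw.1⟩
    have h₁ := hG.dist_add_dist_le_of_separates hS huS hvS
    have h₂ := hmin c hcM
    have h₃ : 0 < G.dist u c := hG.pos_dist_of_ne fun h => hcS (h ▸ huS)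
    rw [G.dist_comm (u := v) (v := u), G.dist_comm (u := v) (v := c)] at h₂
    omega

/-- A minimum consistent subset of a finite connected coloured graph contains at
most one vertex of any pendant monochromatic path. -/
theorem pendant_path_contributes_at_most_one
    {V κ : Type*} [Fintype V] (G : SimpleGraph V) (hG : G.Connected)
    (col : V → κ) {t : ℕ} (p : Fin (t + 1) → V) (hp : IsPendantMonoPath G col p)
    (M : Set V) (hM : IsMinConsistent G col M) :
    ∀ a b : Fin (t + 1), p a ∈ M → p b ∈ M → a = b := by
  suffices h : ∀ a b : Fin (t + 1), p a ∈ M → p b ∈ M → ¬ a < b by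
    intro a b ha hb
    exact le_antisymm (not_lt.mp (h b a hb ha)) (not_lt.mp (h a b ha hb))
  intro a b ha hb hab
  obtain ⟨hinj, hadj, hcol, hout, -⟩ := hp
  obtain ⟨hMc, hmin⟩ := hM
  have hcons : IsConsistent G col (M \ (p '' Set.Ioi a)) := by
    refine hMc.diff_of_separates hG ha ?_ ?_ ?_
    · rintro ⟨j, hj, h⟩
      exact (hinj h).not_gt hj
    · rintro _ ⟨j, hj, rfl⟩ y hy
      have haj : (a : ℕ) < j := hj
      obtain ⟨k, rfl⟩ := hout j (by omega) y hy
      have hjk := (hadj j k).mp hy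
      rcases (show a ≤ k from Fin.le_def.mpr (by omega)).lt_or_eq with hk | rfl
      · exact Or.inl ⟨k, hk, rfl⟩
      · exact Or.inr rfl
    · rintro _ ⟨j, -, rfl⟩
      exact hcol a j
  have hlt : (M \ (p '' Set.Ioi a)).ncard < M.ncard :=
    Set.ncard_lt_ncard
      ⟨Set.sdiff_subset, fun h => (h hb).2 (Set.mem_image_of_mem p hab)⟩ M.toFinite
  exact absurd (hmin _ hcons) (not_le.mpr hlt)
end
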